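/- Let α ∈ (0,1) and let f : ℝ² → ℝ be measurable with |f(x)| ≤ C·|x₂|^{α−1} for all x ∈ ℝ² (for some constant C). Then for all integers j, l ≥ 0 there is a constant C'(α, j, l) such that for all T > 0: (a) ‖∂₁^j ∂₂^l (f * ψ_T)‖_{L^∞(ℝ²)} ≤ C' · C · T^{(2α − 2 − j − 2l)/4}, and (b) the parabolic Hölder seminorm satisfies [f * ψ_T]_α ≤ C'(α) · C · T^{(α−2)/4}. -/

import Mathlib

open MeasureTheory

/-- The parabolic distance on `ℝ²`. -/
noncomputable def pdist (x y : ℝ × ℝ) : ℝ := |x.1 - y.1| + Real.sqrt |x.2 - y.2|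

/-- Partial derivative in the first (space-like) variable. -/
noncomputable def pd1 (f : ℝ × ℝ → ℝ) : ℝ × ℝ → ℝ := fun x => deriv (fun s => f (s, x.2)) x.1

/-- Partial derivative in the second (time-like) variable. -/
noncomputable def pd2 (f : ℝ × ℝ → ℝ) : ℝ × ℝ → ℝ := fun x => deriv (fun s => f (x.1, s)) x.2

def IsPsiKernel (ψ : ℝ → ℝ × ℝ → ℝ) : Prop :=
  (∀ T : ℝ, 0 < T → ∃ φ : SchwartzMap (ℝ × ℝ) ℝ, ψ T = ⇑φ) ∧
  (∃ C : ℝ, ∀ T : ℝ, 0 < T → ∀ k : ℝ × ℝ,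
      (∫ x : ℝ × ℝ,
          Complex.exp (-(2 * Real.pi * (k.1 * x.1 + k.2 * x.2) : ℝ) * Complex.I) * (ψ T x : ℂ))
        = (C : ℂ) * Complex.exp ((-(T * (k.1 ^ 4 + k.2 ^ 2)) : ℝ) : ℂ)) ∧
  (∫ x : ℝ × ℝ, |ψ 1 x|) = 1

/-- Fourier uniqueness for continuous integrable real functions on the plane. -/
lemma eq_zero_of_integral_cexp_mul_eq_zero {g : ℝ × ℝ → ℝ} (hc : Continuous g)
    (hg : Integrable g)
    (h : ∀ k : ℝ × ℝ, ∫ x : ℝ × ℝ, Complex.exp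
      (-(2 * Real.pi * (k.1 * x.1 + k.2 * x.2) : ℝ) * Complex.I) * (g x : ℂ) = 0) :
    g = 0 := by
  have hp : Integrable (fun x => max (g x) 0) := hg.pos_part
  have hn : Integrable (fun x => max (-g x) 0) := hg.neg_part
  have fin1 := isFiniteMeasure_withDensity_ofReal hp.2
  have fin2 := isFiniteMeasure_withDensity_ofReal hn.2
  have mp : Measurable fun x => ENNReal.ofReal (max (g x) 0) := by fun_prop
  have mn : Measurable fun x => ENNReal.ofReal (max (-g x) 0) := by fun_prop
  have key : (volume : Measure (ℝ × ℝ)).withDensity (fun x => ENNReal.ofReal (max (g x) 0)) =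
      (volume : Measure (ℝ × ℝ)).withDensity (fun x => ENNReal.ofReal (max (-g x) 0)) := by
    refine Measure.ext_of_charFunDual (funext fun L => ?_)
    have hL (x : ℝ × ℝ) : L x = x.1 * L (1, 0) + x.2 * L (0, 1) := by
      conv_lhs => rw [show x = x.1 • ((1 : ℝ), (0 : ℝ)) + x.2 • ((0 : ℝ), (1 : ℝ)) by
        ext <;> simp]
      simp only [map_add, map_smul, smul_eq_mul]
    have hE (u : ℝ × ℝ → ℝ) (hu : Integrable u) :
        Integrable (fun x => (u x : ℂ) * Complex.exp (L x * Complex.I)) := by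
      refine (hu.ofReal (𝕜 := ℂ)).mul_bdd (c := 1) (by fun_prop)
        (Filter.Eventually.of_forall fun x => ?_)
      rw [Complex.norm_exp_ofReal_mul_I]
    rw [charFunDual_apply, charFunDual_apply,
      integral_withDensity_eq_integral_toReal_smul mp (by simp),
      integral_withDensity_eq_integral_toReal_smul mn (by simp), ← sub_eq_zero]
    simp only [ENNReal.toReal_ofReal (le_max_right _ _), Complex.real_smul]
    rw [← integral_sub (hE _ hp) (hE _ hn),
      ← h (-L (1, 0) / (2 * Real.pi), -L (0, 1) / (2 * Real.pi))]
    refine integral_congr_ae (Filter.Eventually.of_forall fun x => ?_)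
    have e1 : -(2 * Real.pi * (-L (1, 0) / (2 * Real.pi) * x.1 +
        -L (0, 1) / (2 * Real.pi) * x.2)) = L x := by
      rw [hL x]; field_simp; ring
    have e2 : max (g x) 0 - max (-g x) 0 = g x := by
      rcases le_total (g x) 0 with h0 | h0 <;> simp [h0]
    dsimp only
    rw [← Complex.ofReal_neg, e1, ← sub_mul, ← Complex.ofReal_sub, e2, mul_comm]
  have hae := (withDensity_eq_iff mp.aemeasurable mn.aemeasurable hp.lintegral_lt_top.ne).1 key
  refine (Continuous.ae_eq_iff_eq volume hc continuous_zero).1 ?_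
  filter_upwards [hae] with x hx
  rw [ENNReal.ofReal_eq_ofReal_iff (le_max_right _ _) (le_max_right _ _)] at hx
  rcases le_total (g x) 0 with h0 | h0 <;> simp [h0] at hx <;> simp [hx]

/-- Anisotropic dilations rescale Lebesgue measure on the plane. -/
lemma map_dilation_volume {b c : ℝ} (hb : b ≠ 0) (hc : c ≠ 0) :
    Measure.map (fun x : ℝ × ℝ => (b * x.1, c * x.2)) volume =
      ENNReal.ofReal (|b⁻¹| * |c⁻¹|) • (volume : Measure (ℝ × ℝ)) := by
  have h := Measure.map_prod_map (volume : Measure ℝ) (volume : Measure ℝ)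
    (f := (b * ·)) (g := (c * ·)) (by fun_prop) (by fun_prop)
  rw [Real.map_volume_mul_left hb, Real.map_volume_mul_left hc, Measure.prod_smul_left,
    Measure.prod_smul_right, smul_smul, ← ENNReal.ofReal_mul (abs_nonneg _)] at h
  exact h.symm

lemma measurableEmbedding_dilation {b c : ℝ} (hb : b ≠ 0) (hc : c ≠ 0) :
    MeasurableEmbedding fun x : ℝ × ℝ => (b * x.1, c * x.2) :=
  ((Homeomorph.mulLeft₀ b hb).prodCongr (Homeomorph.mulLeft₀ c hc)).measurableEmbedding

lemma integral_comp_dilation {b c : ℝ} (hb : b ≠ 0) (hc : c ≠ 0) (G : ℝ × ℝ → ℂ) :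
    ∫ x : ℝ × ℝ, G (b * x.1, c * x.2) = (|b⁻¹| * |c⁻¹| : ℝ) * ∫ x, G x := by
  rw [← (measurableEmbedding_dilation hb hc).integral_map G, map_dilation_volume hb hc,
    integral_smul_measure, ENNReal.toReal_ofReal (by positivity), Complex.real_smul]

lemma integrable_comp_dilation {b c : ℝ} (hb : b ≠ 0) (hc : c ≠ 0) {g : ℝ × ℝ → ℝ}
    (hg : Integrable g) : Integrable fun x : ℝ × ℝ => g (b * x.1, c * x.2) := by
  refine ((measurableEmbedding_dilation hb hc).integrable_map_iff (g := g)).1 ?_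
  rw [map_dilation_volume hb hc]
  exact hg.smul_measure ENNReal.ofReal_ne_top

/-- The Fourier transform of the kernel determines it up to parabolic scaling. -/
lemma kernel_scaling {ψ : ℝ → ℝ × ℝ → ℝ}
    (hS : ∀ T : ℝ, 0 < T → ∃ φ : SchwartzMap (ℝ × ℝ) ℝ, ψ T = ⇑φ) {C : ℝ}
    (hF : ∀ T : ℝ, 0 < T → ∀ k : ℝ × ℝ,
      (∫ x : ℝ × ℝ,
          Complex.exp (-(2 * Real.pi * (k.1 * x.1 + k.2 * x.2) : ℝ) * Complex.I) * (ψ T x : ℂ))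
        = (C : ℂ) * Complex.exp ((-(T * (k.1 ^ 4 + k.2 ^ 2)) : ℝ) : ℂ))
    {b : ℝ} (hb : 0 < b) :
    ψ (b ^ 4)⁻¹ = fun x => b ^ 3 * ψ 1 (b * x.1, b ^ 2 * x.2) := by
  have hb0 : b ≠ 0 := hb.ne'
  obtain ⟨φ, hφ⟩ := hS 1 one_pos
  obtain ⟨χ, hχ⟩ := hS (b ^ 4)⁻¹ (by positivity)
  have iφ : Integrable fun x : ℝ × ℝ => b ^ 3 * φ (b * x.1, b ^ 2 * x.2) :=
    (integrable_comp_dilation hb0 (by positivity) φ.integrable).const_mul _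
  have cχ : Continuous χ := χ.continuous
  have cφ : Continuous φ := φ.continuous
  have key := eq_zero_of_integral_cexp_mul_eq_zero
    (g := fun x => χ x - b ^ 3 * φ (b * x.1, b ^ 2 * x.2)) (by fun_prop)
    (χ.integrable.sub iφ) fun k => ?_
  · rw [hχ, hφ]
    funext x
    exact sub_eq_zero.1 (congrFun key x)
  · have hE (u : ℝ × ℝ → ℝ) (hu : Integrable u) :
        Integrable (fun x : ℝ × ℝ => Complex.exp
          (-(2 * Real.pi * (k.1 * x.1 + k.2 * x.2) : ℝ) * Complex.I) * (u x : ℂ)) := by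
      refine (hu.ofReal (𝕜 := ℂ)).bdd_mul (c := 1) (by fun_prop)
        (Filter.Eventually.of_forall fun x => ?_)
      rw [← Complex.ofReal_neg, Complex.norm_exp_ofReal_mul_I]
    simp only [Complex.ofReal_sub, mul_sub]
    rw [integral_sub (hE _ χ.integrable) (hE _ iφ)]
    have h1 := hF (b ^ 4)⁻¹ (by positivity) k
    rw [hχ] at h1
    have h2 := hF 1 one_pos (k.1 / b, k.2 / b ^ 2)
    rw [hφ] at h2
    have h3 := integral_comp_dilation hb0 (pow_ne_zero 2 hb0) fun x => Complex.exp
      (-(2 * Real.pi * (k.1 / b * x.1 + k.2 / b ^ 2 * x.2) : ℝ) * Complex.I) * (φ x : ℂ)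
    rw [h2] at h3
    have h4 : ∀ x : ℝ × ℝ, Complex.exp
        (-(2 * Real.pi * (k.1 * x.1 + k.2 * x.2) : ℝ) * Complex.I) *
          ((b ^ 3 * φ (b * x.1, b ^ 2 * x.2) : ℝ) : ℂ) =
        ((b ^ 3 : ℝ) : ℂ) * (Complex.exp (-(2 * Real.pi * (k.1 / b * (b * x.1) +
          k.2 / b ^ 2 * (b ^ 2 * x.2)) : ℝ) * Complex.I) * (φ (b * x.1, b ^ 2 * x.2) : ℂ)) := by
      intro x
      rw [show k.1 / b * (b * x.1) + k.2 / b ^ 2 * (b ^ 2 * x.2) = k.1 * x.1 + k.2 * x.2 by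
        field_simp, Complex.ofReal_mul (b ^ 3)]
      ring
    rw [h1, integral_congr_ae (Filter.Eventually.of_forall h4), integral_const_mul, h3,
      ← mul_assoc, ← Complex.ofReal_mul, abs_of_pos (inv_pos.2 hb),
      abs_of_pos (inv_pos.2 (pow_pos hb 2)),
      show b ^ 3 * (b⁻¹ * (b ^ 2)⁻¹) = 1 by field_simp, Complex.ofReal_one, one_mul, sub_eq_zero]
    congr 4
    field_simp

/-- The singular weight `|t|^(α-1)` integrated against a dilated Cauchy profile. -/
lemma exists_bound_integral_rpow_mul_inv {α : ℝ} (hα : 0 < α) (hα1 : α < 1) :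
    ∃ M : ℝ, 0 ≤ M ∧ ∀ c : ℝ, 0 < c → ∀ w : ℝ,
      Integrable (fun t : ℝ => |t| ^ (α - 1) * (1 + (c * (w - t)) ^ 2)⁻¹) ∧
      ∫ t : ℝ, |t| ^ (α - 1) * (1 + (c * (w - t)) ^ 2)⁻¹ ≤ M * c ^ (-α) := by
  set h : ℝ → ℝ := (Set.Ioc (0 : ℝ) 1).indicator fun t => t ^ (α - 1) with hh
  have ih : Integrable h := by
    rw [hh, integrable_indicator_iff measurableSet_Ioc,
      ← intervalIntegrable_iff_integrableOn_Ioc_of_le zero_le_one]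
    exact intervalIntegral.intervalIntegrable_rpow' (by linarith)
  have h0 (t : ℝ) : 0 ≤ h t := Set.indicator_nonneg (fun t ht => Real.rpow_nonneg ht.1.le _) t
  have ihn : Integrable fun t => h (-t) := ih.comp_neg
  have hle (t : ℝ) : |t| ^ (α - 1) ≤ h t + h (-t) + 1 := by
    rcases lt_trichotomy t 0 with ht | rfl | ht
    · rcases le_or_gt (-t) 1 with h1 | h1
      · have : h (-t) = |t| ^ (α - 1) := by
          rw [hh, Set.indicator_of_mem (Set.mem_Ioc.2 ⟨neg_pos.2 ht, h1⟩), abs_of_neg ht]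
        linarith [h0 t]
      · have : |t| ^ (α - 1) ≤ 1 :=
          Real.rpow_le_one_of_one_le_of_nonpos (by rw [abs_of_neg ht]; exact h1.le) (by linarith)
        linarith [h0 t, h0 (-t)]
    · rw [abs_zero, Real.zero_rpow (by linarith)]
      linarith [h0 0, h0 (-0)]
    · rcases le_or_gt t 1 with h1 | h1
      · have : h t = |t| ^ (α - 1) := by
          rw [hh, Set.indicator_of_mem (Set.mem_Ioc.2 ⟨ht, h1⟩), abs_of_pos ht]
        linarith [h0 (-t)]
      · have : |t| ^ (α - 1) ≤ 1 :=
          Real.rpow_le_one_of_one_le_of_nonpos (by rw [abs_of_pos ht]; exact h1.le) (by linarith)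
        linarith [h0 t, h0 (-t)]
  have icauchy (w : ℝ) : Integrable fun t : ℝ => (1 + (w - t) ^ 2)⁻¹ :=
    integrable_inv_one_add_sq.comp_sub_left w
  have hpt (w t : ℝ) : |t| ^ (α - 1) * (1 + (w - t) ^ 2)⁻¹ ≤
      h t + h (-t) + (1 + (w - t) ^ 2)⁻¹ := by
    have h1 : (1 + (w - t) ^ 2)⁻¹ ≤ 1 := inv_le_one_of_one_le₀ (by nlinarith [sq_nonneg (w - t)])
    have h2 : 0 ≤ (1 + (w - t) ^ 2)⁻¹ := by positivity
    nlinarith [mul_le_mul_of_nonneg_right (hle t) h2, h0 t, h0 (-t)]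
  have idom (w : ℝ) : Integrable fun t => h t + h (-t) + (1 + (w - t) ^ 2)⁻¹ :=
    (ih.add ihn).add (icauchy w)
  have iunit (w : ℝ) : Integrable fun t : ℝ => |t| ^ (α - 1) * (1 + (w - t) ^ 2)⁻¹ := by
    refine (idom w).mono' (by fun_prop) (Filter.Eventually.of_forall fun t => ?_)
    rw [Real.norm_of_nonneg (by positivity)]
    exact hpt w t
  refine ⟨(∫ t, h t) + (∫ t, h (-t)) + Real.pi, ?_, fun c hc w => ?_⟩
  · exact add_nonneg (add_nonneg (integral_nonneg h0) (integral_nonneg fun t => h0 (-t)))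
      Real.pi_pos.le
  · have hscale (t : ℝ) : |t| ^ (α - 1) * (1 + (c * (w - t)) ^ 2)⁻¹ =
        c ^ (1 - α) * (|c * t| ^ (α - 1) * (1 + (c * w - c * t) ^ 2)⁻¹) := by
      rw [abs_mul, abs_of_pos hc, Real.mul_rpow hc.le (abs_nonneg t), ← mul_assoc, ← mul_assoc,
        ← Real.rpow_add hc, mul_sub]
      simp
    simp only [hscale]
    refine ⟨((iunit (c * w)).comp_mul_left' hc.ne').const_mul _, ?_⟩
    rw [integral_const_mul, Measure.integral_comp_mul_left
      (fun t => |t| ^ (α - 1) * (1 + (c * w - t) ^ 2)⁻¹), abs_of_pos (inv_pos.2 hc), smul_eq_mul,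
      ← mul_assoc, ← Real.rpow_neg_one c, ← Real.rpow_add hc, mul_comm,
      show 1 - α + -1 = -α by ring]
    refine mul_le_mul_of_nonneg_right ?_ (Real.rpow_nonneg hc.le _)
    refine (integral_mono (iunit _) (idom _) (hpt _)).trans_eq ?_
    rw [integral_add (f := fun t => h t + h (-t)) (ih.add ihn) (icauchy _), integral_add ih ihn,
      integral_sub_left_eq_self (fun t : ℝ => (1 + t ^ 2)⁻¹) volume, integral_univ_inv_one_add_sq]

/-- A product of Cauchy profiles, used to dominate Schwartz functions on the plane. -/
noncomputable def cauchyWeight (x : ℝ × ℝ) : ℝ := (1 + x.1 ^ 2)⁻¹ * (1 + x.2 ^ 2)⁻¹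

lemma cauchyWeight_pos (x : ℝ × ℝ) : 0 < cauchyWeight x := by
  unfold cauchyWeight; positivity

lemma inv_one_add_sq_sub_le (a b : ℝ) : (1 + (a - b) ^ 2)⁻¹ ≤ 2 * (1 + a ^ 2) * (1 + b ^ 2)⁻¹ := by
  rw [inv_eq_one_div, ← div_eq_mul_inv, div_le_div_iff₀ (by positivity) (by positivity)]
  nlinarith [sq_nonneg (a * (a - b)), sq_nonneg (2 * a - b)]

lemma cauchyWeight_sub_le (x y : ℝ × ℝ) :
    cauchyWeight (x - y) ≤ 4 * (1 + x.1 ^ 2) * (1 + x.2 ^ 2) * cauchyWeight y := by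
  refine (mul_le_mul (inv_one_add_sq_sub_le x.1 y.1) (inv_one_add_sq_sub_le x.2 y.2)
    (by positivity) (by positivity)).trans_eq ?_
  unfold cauchyWeight
  ring

lemma exists_abs_le_cauchyWeight (φ : SchwartzMap (ℝ × ℝ) ℝ) :
    ∃ K : ℝ, 0 ≤ K ∧ ∀ x, |φ x| ≤ K * cauchyWeight x := by
  obtain ⟨A, -, hA⟩ := φ.decay 0 0
  obtain ⟨B, -, hB⟩ := φ.decay 2 0
  obtain ⟨D, -, hD⟩ := φ.decay 4 0
  simp only [norm_iteratedFDeriv_zero, pow_zero, one_mul, Real.norm_eq_abs] at hA hB hD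
  have key (x : ℝ × ℝ) : |φ x| * ((1 + x.1 ^ 2) * (1 + x.2 ^ 2)) ≤ A + 2 * B + D := by
    have h1 : x.1 ^ 2 ≤ ‖x‖ ^ 2 := sq_le_sq.2 (by simpa using norm_fst_le x)
    have h2 : x.2 ^ 2 ≤ ‖x‖ ^ 2 := sq_le_sq.2 (by simpa using norm_snd_le x)
    have h3 : (1 + x.1 ^ 2) * (1 + x.2 ^ 2) ≤ 1 + 2 * ‖x‖ ^ 2 + ‖x‖ ^ 4 := by
      nlinarith [mul_le_mul h1 h2 (sq_nonneg _) (sq_nonneg _)]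
    nlinarith [mul_le_mul_of_nonneg_left h3 (abs_nonneg (φ x)), hA x, hB x, hD x]
  refine ⟨A + 2 * B + D, (by positivity : (0 : ℝ) ≤ _).trans (key 0), fun x => ?_⟩
  rw [cauchyWeight, ← mul_inv, ← div_eq_mul_inv, le_div_iff₀ (by positivity)]
  exact key x

/-- The singular weight `|y₂|^(α-1)` integrated against a parabolically dilated
`cauchyWeight`. -/
lemma exists_bound_integral_rpow_mul_cauchyWeight {α : ℝ} (hα : 0 < α) (hα1 : α < 1) :
    ∃ M : ℝ, 0 ≤ M ∧ ∀ b : ℝ, 0 < b → ∀ x : ℝ × ℝ,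
      Integrable (fun y : ℝ × ℝ => |y.2| ^ (α - 1) *
        cauchyWeight (b * (x - y).1, b ^ 2 * (x - y).2)) ∧
      ∫ y : ℝ × ℝ, |y.2| ^ (α - 1) * cauchyWeight (b * (x - y).1, b ^ 2 * (x - y).2) ≤
        M * b ^ (-1 - 2 * α) := by
  obtain ⟨M, hM, h⟩ := exists_bound_integral_rpow_mul_inv hα hα1
  refine ⟨Real.pi * M, by positivity, fun b hb x => ?_⟩
  have h1 : Integrable fun t : ℝ => (1 + (b * (x.1 - t)) ^ 2)⁻¹ :=
    (integrable_inv_one_add_sq.comp_mul_left' hb.ne').comp_sub_left x.1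
  have h2 := h (b ^ 2) (by positivity) x.2
  have e : (fun y : ℝ × ℝ => |y.2| ^ (α - 1) *
        cauchyWeight (b * (x - y).1, b ^ 2 * (x - y).2)) = fun y =>
      (1 + (b * (x.1 - y.1)) ^ 2)⁻¹ * (|y.2| ^ (α - 1) * (1 + (b ^ 2 * (x.2 - y.2)) ^ 2)⁻¹) := by
    funext y
    simp only [cauchyWeight, Prod.fst_sub, Prod.snd_sub]
    ring
  rw [e]
  refine ⟨h1.mul_prod h2.1, ?_⟩
  rw [Measure.volume_eq_prod, integral_prod_mul (fun t : ℝ => (1 + (b * (x.1 - t)) ^ 2)⁻¹)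
      (fun t : ℝ => |t| ^ (α - 1) * (1 + (b ^ 2 * (x.2 - t)) ^ 2)⁻¹),
    integral_sub_left_eq_self (fun t : ℝ => (1 + (b * t) ^ 2)⁻¹) volume,
    Measure.integral_comp_mul_left (fun t : ℝ => (1 + t ^ 2)⁻¹), integral_univ_inv_one_add_sq,
    abs_of_pos (inv_pos.2 hb), smul_eq_mul]
  refine (mul_le_mul_of_nonneg_left h2.2 (by positivity)).trans_eq ?_
  rw [← Real.rpow_natCast b 2, ← Real.rpow_mul hb.le, sub_eq_add_neg, Real.rpow_add hb,
    Real.rpow_neg_one]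
  push_cast
  ring_nf

lemma ae_snd_ne_zero : ∀ᵐ y : ℝ × ℝ, y.2 ≠ 0 :=
  Measure.quasiMeasurePreserving_snd.ae (Measure.ae_ne volume (0 : ℝ))

/-- Convolution on the plane. -/
noncomputable def planeConv (f g : ℝ × ℝ → ℝ) (x : ℝ × ℝ) : ℝ := ∫ y, f y * g (x - y)

/-- The class of forcings that are singular like `|x₂|^(α-1)` at the initial time. -/
structure SingularForcing (α Cf : ℝ) (f : ℝ × ℝ → ℝ) : Prop where
  measurable : Measurable f
  bound : ∀ x : ℝ × ℝ, x.2 ≠ 0 → |f x| ≤ Cf * |x.2| ^ (α - 1)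

namespace SingularForcing

variable {α Cf : ℝ} {f : ℝ × ℝ → ℝ}

lemma nonneg (hf : SingularForcing α Cf f) : 0 ≤ Cf := by
  have h := hf.bound (0, 1) one_ne_zero
  simp only [abs_one, Real.one_rpow, mul_one] at h
  exact (abs_nonneg _).trans h

lemma abs_mul_le (hf : SingularForcing α Cf f) {y : ℝ × ℝ} (hy : y.2 ≠ 0) {a c : ℝ}
    (h : |a| ≤ c) : |f y * a| ≤ Cf * |y.2| ^ (α - 1) * c := by
  rw [abs_mul]
  exact mul_le_mul (hf.bound y hy) h (abs_nonneg _) ((abs_nonneg _).trans (hf.bound y hy))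

lemma aestronglyMeasurable_mul (hf : SingularForcing α Cf f) {g : ℝ × ℝ → ℝ} (hg : Continuous g)
    (x : ℝ × ℝ) : AEStronglyMeasurable (fun y => f y * g (x - y)) volume :=
  hf.measurable.aestronglyMeasurable.mul (by fun_prop)

lemma integrable_rpow_mul_cauchyWeight (hα : 0 < α) (hα1 : α < 1) :
    Integrable fun y : ℝ × ℝ => |y.2| ^ (α - 1) * cauchyWeight y := by
  obtain ⟨M, -, h⟩ := exists_bound_integral_rpow_mul_cauchyWeight hα hα1
  refine (h 1 one_pos 0).1.congr (Filter.Eventually.of_forall fun y => ?_)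
  simp [cauchyWeight]

lemma hasDerivAt_planeConv (hα : 0 < α) (hα1 : α < 1) (hf : SingularForcing α Cf f)
    (φ : SchwartzMap (ℝ × ℝ) ℝ) (p v : ℝ × ℝ) (s : ℝ) :
    HasDerivAt (fun s : ℝ => planeConv f φ (p + s • v))
      (planeConv f (LineDeriv.lineDerivOp v φ : SchwartzMap (ℝ × ℝ) ℝ) (p + s • v)) s := by
  set χ : SchwartzMap (ℝ × ℝ) ℝ := LineDeriv.lineDerivOp v φ with hχ
  obtain ⟨K, hK, hφK⟩ := exists_abs_le_cauchyWeight φ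
  obtain ⟨L, hL, hχL⟩ := exists_abs_le_cauchyWeight χ
  have hw (q y : ℝ × ℝ) := cauchyWeight_sub_le q y
  obtain ⟨R, hR⟩ := (isCompact_closedBall s 1).exists_bound_of_continuousOn
    (f := fun s : ℝ => 4 * (1 + (p + s • v).1 ^ 2) * (1 + (p + s • v).2 ^ 2))
    (Continuous.continuousOn (by fun_prop))
  have hdom {g : ℝ × ℝ → ℝ} {A : ℝ} (hA : 0 ≤ A) (hg : ∀ x, |g x| ≤ A * cauchyWeight x)
      {y : ℝ × ℝ} (hy : y.2 ≠ 0) {t : ℝ} (ht : t ∈ Metric.closedBall s 1) :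
      ‖f y * g (p + t • v - y)‖ ≤ Cf * (A * R) * (|y.2| ^ (α - 1) * cauchyWeight y) := by
    have h1 : |g (p + t • v - y)| ≤ A * (R * cauchyWeight y) :=
      (hg _).trans (mul_le_mul_of_nonneg_left ((hw _ _).trans (mul_le_mul_of_nonneg_right
        ((le_abs_self _).trans (hR t ht)) (cauchyWeight_pos y).le)) hA)
    refine (hf.abs_mul_le hy h1).trans_eq (by ring)
  have hdominated (A : ℝ) := (integrable_rpow_mul_cauchyWeight hα hα1).const_mul (Cf * (A * R))
  refine (hasDerivAt_integral_of_dominated_loc_of_deriv_le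
    (F := fun t y => f y * φ (p + t • v - y)) (F' := fun t y => f y * χ (p + t • v - y))
    (Metric.closedBall_mem_nhds s one_pos)
    (Filter.Eventually.of_forall fun t => hf.aestronglyMeasurable_mul φ.continuous _)
    ((hdominated K).mono' (hf.aestronglyMeasurable_mul φ.continuous _) ?_)
    (hf.aestronglyMeasurable_mul χ.continuous _)
    ?_ (hdominated L) ?_).2
  · filter_upwards [ae_snd_ne_zero] with y hy
    exact hdom hK hφK hy (Metric.mem_closedBall_self zero_le_one)
  · filter_upwards [ae_snd_ne_zero] with y hy t ht
    exact hdom hL hχL hy ht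
  · refine Filter.Eventually.of_forall fun y t _ => HasDerivAt.const_mul _ ?_
    have h1 : HasDerivAt (fun t : ℝ => p + t • v - y) v t := by
      simpa using (((hasDerivAt_id t).smul_const v).const_add p).sub_const y
    rw [hχ, SchwartzMap.lineDerivOp_apply_eq_fderiv]
    exact φ.differentiableAt.hasFDerivAt.comp_hasDerivAt t h1

lemma hasDerivAt_planeConv_fst (hα : 0 < α) (hα1 : α < 1) (hf : SingularForcing α Cf f)
    (φ : SchwartzMap (ℝ × ℝ) ℝ) (x : ℝ × ℝ) :
    HasDerivAt (fun s : ℝ => planeConv f φ (s, x.2))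
      (planeConv f (LineDeriv.lineDerivOp ((1 : ℝ), (0 : ℝ)) φ : SchwartzMap (ℝ × ℝ) ℝ) x) x.1 := by
  simpa using hf.hasDerivAt_planeConv hα hα1 φ (0, x.2) (1, 0) x.1

lemma hasDerivAt_planeConv_snd (hα : 0 < α) (hα1 : α < 1) (hf : SingularForcing α Cf f)
    (φ : SchwartzMap (ℝ × ℝ) ℝ) (x : ℝ × ℝ) :
    HasDerivAt (fun s : ℝ => planeConv f φ (x.1, s))
      (planeConv f (LineDeriv.lineDerivOp ((0 : ℝ), (1 : ℝ)) φ : SchwartzMap (ℝ × ℝ) ℝ) x) x.2 := by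
  simpa using hf.hasDerivAt_planeConv hα hα1 φ (x.1, 0) (0, 1) x.2

end SingularForcing

lemma pd1_schwartz (φ : SchwartzMap (ℝ × ℝ) ℝ) :
    ⇑(LineDeriv.lineDerivOp ((1 : ℝ), (0 : ℝ)) φ : SchwartzMap (ℝ × ℝ) ℝ) = pd1 φ := by
  funext x
  have h1 : HasDerivAt (fun s : ℝ => (s, x.2)) ((1 : ℝ), (0 : ℝ)) x.1 :=
    (hasDerivAt_id _).prodMk (hasDerivAt_const _ _)
  rw [SchwartzMap.lineDerivOp_apply_eq_fderiv]
  exact ((φ.differentiableAt (x := x)).hasFDerivAt.comp_hasDerivAt x.1 h1).deriv.symm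

lemma pd2_schwartz (φ : SchwartzMap (ℝ × ℝ) ℝ) :
    ⇑(LineDeriv.lineDerivOp ((0 : ℝ), (1 : ℝ)) φ : SchwartzMap (ℝ × ℝ) ℝ) = pd2 φ := by
  funext x
  have h1 : HasDerivAt (fun s : ℝ => (x.1, s)) ((0 : ℝ), (1 : ℝ)) x.2 :=
    (hasDerivAt_const _ _).prodMk (hasDerivAt_id _)
  rw [SchwartzMap.lineDerivOp_apply_eq_fderiv]
  exact ((φ.differentiableAt (x := x)).hasFDerivAt.comp_hasDerivAt x.2 h1).deriv.symm

/-- Iterated mixed partial derivatives preserve the Schwartz class and may be moved from the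
convolution with a singular forcing onto the kernel. -/
lemma exists_schwartz_iterate_pd (j l : ℕ) (φ : SchwartzMap (ℝ × ℝ) ℝ) :
    ∃ χ : SchwartzMap (ℝ × ℝ) ℝ, ⇑χ = pd1^[j] (pd2^[l] φ) ∧
      ∀ {α Cf : ℝ} {f : ℝ × ℝ → ℝ}, 0 < α → α < 1 → SingularForcing α Cf f →
        pd1^[j] (pd2^[l] (planeConv f φ)) = planeConv f χ := by
  have s1 : Function.Semiconj (fun χ : SchwartzMap (ℝ × ℝ) ℝ => ⇑χ)
      (fun χ => LineDeriv.lineDerivOp ((1 : ℝ), (0 : ℝ)) χ) pd1 := pd1_schwartz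
  have s2 : Function.Semiconj (fun χ : SchwartzMap (ℝ × ℝ) ℝ => ⇑χ)
      (fun χ => LineDeriv.lineDerivOp ((0 : ℝ), (1 : ℝ)) χ) pd2 := pd2_schwartz
  refine ⟨_, (s1.iterate_right j _).trans (congrArg (pd1^[j]) (s2.iterate_right l φ)),
    fun {α Cf f} hα hα1 hf => ?_⟩
  have c1 : Function.Semiconj (fun χ : SchwartzMap (ℝ × ℝ) ℝ => planeConv f χ)
      (fun χ => LineDeriv.lineDerivOp ((1 : ℝ), (0 : ℝ)) χ) pd1 := fun χ => funext fun x =>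
    (hf.hasDerivAt_planeConv_fst hα hα1 χ x).deriv.symm
  have c2 : Function.Semiconj (fun χ : SchwartzMap (ℝ × ℝ) ℝ => planeConv f χ)
      (fun χ => LineDeriv.lineDerivOp ((0 : ℝ), (1 : ℝ)) χ) pd2 := fun χ => funext fun x =>
    (hf.hasDerivAt_planeConv_snd hα hα1 χ x).deriv.symm
  exact ((c1.iterate_right j _).trans (congrArg (pd1^[j]) (c2.iterate_right l φ))).symm

lemma iterate_pd_dilation (j l : ℕ) (a b c : ℝ) (g : ℝ × ℝ → ℝ) :
    pd1^[j] (pd2^[l] fun x => a * g (b * x.1, c * x.2)) =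
      fun x => a * b ^ j * c ^ l * pd1^[j] (pd2^[l] g) (b * x.1, c * x.2) := by
  have h1 (a : ℝ) (g : ℝ × ℝ → ℝ) : pd1 (fun x => a * g (b * x.1, c * x.2)) =
      fun x => a * b * pd1 g (b * x.1, c * x.2) := by
    funext x
    simp only [pd1]
    rw [deriv_const_mul_field, deriv_comp_mul_left b (fun s => g (s, c * x.2)), smul_eq_mul,
      mul_assoc]
  have h2 (a : ℝ) (g : ℝ × ℝ → ℝ) : pd2 (fun x => a * g (b * x.1, c * x.2)) =
      fun x => a * c * pd2 g (b * x.1, c * x.2) := by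
    funext x
    simp only [pd2]
    rw [deriv_const_mul_field, deriv_comp_mul_left c (fun s => g (b * x.1, s)), smul_eq_mul,
      mul_assoc]
  have i2 : pd2^[l] (fun x => a * g (b * x.1, c * x.2)) =
      fun x => a * c ^ l * pd2^[l] g (b * x.1, c * x.2) := by
    induction l with
    | zero => simp
    | succ n ih => rw [Function.iterate_succ_apply', ih, h2, Function.iterate_succ_apply', pow_succ,
        mul_assoc]
  rw [i2]
  generalize pd2^[l] g = u
  induction j with
  | zero => simp
  | succ n ih =>
    rw [Function.iterate_succ_apply', ih, h1, Function.iterate_succ_apply']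
    funext x
    ring

/-- Pointwise bounds on the derivatives of the convolution, in terms of the inverse length
scale `b = T^(-1/4)`. -/
lemma exists_bound_iterate_pd_planeConv {ψ : ℝ → ℝ × ℝ → ℝ} (hψ : IsPsiKernel ψ)
    {α : ℝ} (hα : 0 < α) (hα1 : α < 1) (j l : ℕ) :
    ∃ A : ℝ, 0 ≤ A ∧ ∀ {Cf : ℝ} {f : ℝ × ℝ → ℝ}, SingularForcing α Cf f → ∀ b : ℝ, 0 < b →
      ∀ x, |pd1^[j] (pd2^[l] (planeConv f (ψ (b ^ 4)⁻¹))) x| ≤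
        A * Cf * (b ^ (2 - 2 * α) * b ^ (j + 2 * l)) := by
  obtain ⟨hS, ⟨C, hF⟩, -⟩ := hψ
  obtain ⟨M, hM, hMb⟩ := exists_bound_integral_rpow_mul_cauchyWeight hα hα1
  obtain ⟨φ, hφ⟩ := hS 1 one_pos
  obtain ⟨η, hη, -⟩ := exists_schwartz_iterate_pd j l φ
  obtain ⟨K, hK, hηK⟩ := exists_abs_le_cauchyWeight η
  refine ⟨M * K, by positivity, fun {Cf f} hf b hb x => ?_⟩
  have hCf := hf.nonneg
  have hscale := kernel_scaling hS hF hb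
  obtain ⟨χ, hχ⟩ := hS (b ^ 4)⁻¹ (by positivity)
  obtain ⟨ω, hω, hconv⟩ := exists_schwartz_iterate_pd j l χ
  rw [hχ, hconv hα hα1 hf]
  rw [← hχ, hscale, hφ, iterate_pd_dilation, ← hη] at hω
  set P : ℝ := b ^ 3 * b ^ j * (b ^ 2) ^ l with hP
  have hωb (z : ℝ × ℝ) : |ω z| ≤ P * (K * cauchyWeight (b * z.1, b ^ 2 * z.2)) := by
    rw [hω, abs_mul, abs_of_nonneg (by positivity)]
    exact mul_le_mul_of_nonneg_left (hηK _) (by positivity)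
  obtain ⟨hi, hle⟩ := hMb b hb x
  have hmain : |planeConv f ω x| ≤ ∫ y : ℝ × ℝ, Cf * P * K *
      (|y.2| ^ (α - 1) * cauchyWeight (b * (x - y).1, b ^ 2 * (x - y).2)) := by
    rw [← Real.norm_eq_abs, planeConv]
    refine norm_integral_le_of_norm_le (hi.const_mul _) ?_
    filter_upwards [ae_snd_ne_zero] with y hy
    exact (hf.abs_mul_le hy (hωb (x - y))).trans_eq (by ring)
  rw [integral_const_mul] at hmain
  refine (hmain.trans (mul_le_mul_of_nonneg_left hle (by positivity))).trans_eq ?_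
  have hpow : b ^ (2 - 2 * α) = b ^ 3 * b ^ (-1 - 2 * α) := by
    rw [← Real.rpow_natCast b 3, ← Real.rpow_add hb]
    congr 1
    push_cast
    ring
  rw [hpow, hP]
  ring

lemma abs_le_mul_rpow_of_le {u P Q r α : ℝ} (hα : 0 < α) (hα1 : α < 1) (hP : 0 ≤ P)
    (hQ : 0 ≤ Q) (hr : 0 ≤ r) {n : ℕ} (hn : n ≠ 0) (h1 : |u| ≤ P) (h2 : |u| ≤ Q * r ^ n) :
    |u| ≤ (P + Q) * r ^ α := by
  have h0 : 0 ≤ r ^ α := Real.rpow_nonneg hr _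
  rcases le_total r 1 with h | h
  · have h3 : r ^ n ≤ r ^ α :=
      (pow_le_of_le_one hr h hn).trans (Real.self_le_rpow_of_le_one hr h hα1.le)
    nlinarith [mul_le_mul_of_nonneg_left h3 hQ, mul_nonneg hP h0]
  · have h3 : 1 ≤ r ^ α := Real.one_le_rpow h hα.le
    nlinarith [mul_le_mul_of_nonneg_left h3 hP, mul_nonneg hQ h0]

lemma abs_sub_le_of_abs_deriv_le {g : ℝ → ℝ} (hg : Differentiable ℝ g) {B : ℝ}
    (h : ∀ s, |deriv g s| ≤ B) (s t : ℝ) : |g s - g t| ≤ B * |s - t| :=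
  convex_univ.norm_image_sub_le_of_norm_deriv_le (fun x _ => hg x) (fun x _ => h x)
    (Set.mem_univ t) (Set.mem_univ s)

/-- The parabolic Hölder bound, in terms of the inverse length scale `b = T^(-1/4)`. -/
lemma exists_holder_bound_planeConv {ψ : ℝ → ℝ × ℝ → ℝ} (hψ : IsPsiKernel ψ)
    {α : ℝ} (hα : 0 < α) (hα1 : α < 1) :
    ∃ A : ℝ, ∀ {Cf : ℝ} {f : ℝ × ℝ → ℝ}, SingularForcing α Cf f → ∀ b : ℝ, 0 < b → ∀ x y,
      |planeConv f (ψ (b ^ 4)⁻¹) x - planeConv f (ψ (b ^ 4)⁻¹) y| ≤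
        A * Cf * b ^ (2 - α) * pdist x y ^ α := by
  obtain ⟨A₀, hA₀, h₀⟩ := exists_bound_iterate_pd_planeConv hψ hα hα1 0 0
  obtain ⟨A₁, hA₁, h₁⟩ := exists_bound_iterate_pd_planeConv hψ hα hα1 1 0
  obtain ⟨A₂, hA₂, h₂⟩ := exists_bound_iterate_pd_planeConv hψ hα hα1 0 1
  refine ⟨4 * A₀ + A₁ + A₂, fun {Cf f} hf b hb x y => ?_⟩
  have hCf := hf.nonneg
  replace h₀ := h₀ hf b hb
  replace h₁ := h₁ hf b hb
  replace h₂ := h₂ hf b hb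
  obtain ⟨χ, hχ⟩ := hψ.1 (b ^ 4)⁻¹ (by positivity)
  rw [hχ] at h₀ h₁ h₂ ⊢
  simp only [Function.iterate_zero, Function.iterate_one, id, add_zero, mul_zero, pow_zero,
    mul_one, pow_one, zero_add] at h₀ h₁ h₂
  set F := planeConv f χ with hF
  set N : ℝ := b ^ (2 - 2 * α) with hN
  have hN0 : 0 ≤ N := Real.rpow_nonneg hb.le _
  have hosc (p q : ℝ × ℝ) : |F p - F q| ≤ 2 * A₀ * Cf * N := by
    linarith [abs_sub (F p) (F q), h₀ p, h₀ q]
  have hpow : b ^ (2 - α) = N * b ^ α := by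
    rw [hN, ← Real.rpow_add hb]
    congr 1
    ring
  have k1 : |F x - F (y.1, x.2)| ≤ (2 * A₀ * Cf * N + A₁ * Cf * N) * (b * |x.1 - y.1|) ^ α := by
    refine abs_le_mul_rpow_of_le hα hα1 (by positivity) (by positivity) (by positivity)
      one_ne_zero (hosc _ _) ?_
    refine (abs_sub_le_of_abs_deriv_le (g := fun s => F (s, x.2))
      (fun s => (hf.hasDerivAt_planeConv_fst hα hα1 χ (s, x.2)).differentiableAt)
      (fun s => h₁ (s, x.2)) x.1 y.1).trans_eq (by ring)
  have k2 : |F (y.1, x.2) - F y| ≤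
      (2 * A₀ * Cf * N + A₂ * Cf * N) * (b * √|x.2 - y.2|) ^ α := by
    refine abs_le_mul_rpow_of_le hα hα1 (by positivity) (by positivity) (by positivity)
      two_ne_zero (hosc _ _) ?_
    refine (abs_sub_le_of_abs_deriv_le (g := fun s => F (y.1, s))
      (fun s => (hf.hasDerivAt_planeConv_snd hα hα1 χ (y.1, s)).differentiableAt)
      (fun s => h₂ (y.1, s)) x.2 y.2).trans_eq ?_
    rw [mul_pow, Real.sq_sqrt (abs_nonneg _)]
    ring
  have d1 : (b * |x.1 - y.1|) ^ α ≤ b ^ α * pdist x y ^ α := by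
    rw [Real.mul_rpow hb.le (abs_nonneg _)]
    have : |x.1 - y.1| ≤ pdist x y := le_add_of_nonneg_right (Real.sqrt_nonneg _)
    gcongr
  have d2 : (b * √|x.2 - y.2|) ^ α ≤ b ^ α * pdist x y ^ α := by
    rw [Real.mul_rpow hb.le (Real.sqrt_nonneg _)]
    have : √|x.2 - y.2| ≤ pdist x y := le_add_of_nonneg_left (abs_nonneg _)
    gcongr
  calc |F x - F y| ≤ |F x - F (y.1, x.2)| + |F (y.1, x.2) - F y| := abs_sub_le _ _ _
    _ ≤ (2 * A₀ * Cf * N + A₁ * Cf * N) * (b ^ α * pdist x y ^ α) +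
        (2 * A₀ * Cf * N + A₂ * Cf * N) * (b ^ α * pdist x y ^ α) :=
      add_le_add (k1.trans (mul_le_mul_of_nonneg_left d1 (by positivity)))
        (k2.trans (mul_le_mul_of_nonneg_left d2 (by positivity)))
    _ = (4 * A₀ + A₁ + A₂) * Cf * b ^ (2 - α) * pdist x y ^ α := by rw [hpow]; ring

lemma inv_rpow_neg_quarter_pow_four {T : ℝ} (hT : 0 < T) : ((T ^ (-(1 / 4) : ℝ)) ^ 4)⁻¹ = T := by
  rw [← Real.rpow_natCast, ← Real.rpow_mul hT.le, ← Real.rpow_neg hT.le]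
  norm_num

/-- bounds for `f * ψ_T` when `|f(x)| ≤ C·|x₂|^{α-1}`. -/
theorem convolution_bounds_singular_forcing
    (ψ : ℝ → ℝ × ℝ → ℝ) (hψ : IsPsiKernel ψ)
    (α : ℝ) (hα : 0 < α) (hα1 : α < 1) :
    (∀ j l : ℕ, ∃ C' : ℝ, ∀ (f : ℝ × ℝ → ℝ) (Cf : ℝ), Measurable f →
      (∀ x : ℝ × ℝ, x.2 ≠ 0 → |f x| ≤ Cf * |x.2| ^ (α - 1)) →
      ∀ T : ℝ, 0 < T → ∀ x : ℝ × ℝ,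
        |(pd1^[j] (pd2^[l] (fun z : ℝ × ℝ => ∫ y : ℝ × ℝ, f y * ψ T (z - y)))) x|
          ≤ C' * Cf * T ^ ((2 * α - 2 - (j : ℝ) - 2 * (l : ℝ)) / 4)) ∧
    (∃ C'' : ℝ, ∀ (f : ℝ × ℝ → ℝ) (Cf : ℝ), Measurable f →
      (∀ x : ℝ × ℝ, x.2 ≠ 0 → |f x| ≤ Cf * |x.2| ^ (α - 1)) →
      ∀ T : ℝ, 0 < T → ∀ x y : ℝ × ℝ,
        |(∫ z : ℝ × ℝ, f z * ψ T (x - z)) - (∫ z : ℝ × ℝ, f z * ψ T (y - z))|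
          ≤ C'' * Cf * T ^ ((α - 2) / 4) * pdist x y ^ α) := by
  refine ⟨fun j l => ?_, ?_⟩
  · obtain ⟨A, -, h⟩ := exists_bound_iterate_pd_planeConv hψ hα hα1 j l
    refine ⟨A, fun f Cf hm hb T hT x => ?_⟩
    have h1 := h ⟨hm, hb⟩ (T ^ (-(1 / 4) : ℝ)) (Real.rpow_pos_of_pos hT _) x
    rw [inv_rpow_neg_quarter_pow_four hT, ← Real.rpow_natCast _ (j + 2 * l), ← Real.rpow_mul hT.le,
      ← Real.rpow_mul hT.le, ← Real.rpow_add hT] at h1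
    refine h1.trans_eq ?_
    congr 2
    push_cast
    ring
  · obtain ⟨A, h⟩ := exists_holder_bound_planeConv hψ hα hα1
    refine ⟨A, fun f Cf hm hb T hT x y => ?_⟩
    have h1 := h ⟨hm, hb⟩ (T ^ (-(1 / 4) : ℝ)) (Real.rpow_pos_of_pos hT _) x y
    rw [inv_rpow_neg_quarter_pow_four hT, ← Real.rpow_mul hT.le] at h1
    refine h1.trans_eq ?_
    congr 3
    ring
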